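/- Let w be a square-free walk in the digraph D of length at least 2, and write w = x w' y with x, y ∈ V(D). Then every word in the set δ(p_x w s_y) is extremal square-free. -/

import Mathlib

/-- A word `w` is square-free if it contains no factor `x ++ x` with `x` nonempty. -/
def SquareFree {α : Type*} (w : List α) : Prop :=
  ∀ x : List α, x ≠ [] → ¬ (x ++ x) <:+: w

/-- `v` is an extension of `w`: insert a single letter anywhere in `w`. -/
def IsExtension {α : Type*} (w v : List α) : Prop :=
  ∃ (w' w'' : List α) (a : α), w = w' ++ w'' ∧ v = w' ++ [a] ++ w''

/-- `w` is extremal square-free. -/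
def ExtremalSquareFree {α : Type*} (w : List α) : Prop :=
  SquareFree w ∧ ∀ v, IsExtension w v → ¬ SquareFree v

/-- Extension of a set-valued substitution from letters to words:
`SubstSet f (a₁ ⋯ aₙ) = {A₁ ++ ⋯ ++ Aₙ : Aᵢ ∈ f aᵢ}`. -/
def SubstSet {α β : Type*} (f : α → Set (List β)) : List α → Set (List β)
  | [] => {[]}
  | a :: w => {W | ∃ A ∈ f a, ∃ B ∈ SubstSet f w, W = A ++ B}

/-- The word `P = abacbcabcbacabacbcabcbabcacbcabcbacabacbcabcbacbc` (a=0, b=1, c=2). -/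
def Pw : List (Fin 3) :=
  [0,1,0,2,1,2,0,1,2,1,0,2,0,1,0,2,1,2,0,1,2,1,0,1,2,0,2,1,2,0,1,2,1,0,2,0,1,0,2,1,2,0,1,2,1,0,2,1,2]

/-- The word `Q = abacbabcacbacabacbcacbacabcbabcabacbcabcb`. -/
def Qw : List (Fin 3) :=
  [0,1,0,2,1,0,1,2,0,2,1,0,2,0,1,0,2,1,2,0,2,1,0,2,0,1,2,1,0,1,2,0,1,0,2,1,2,0,1,2,1]

/-- The word `R = abacabcacbacabcbabcacbacabacbcacbacabcbabcabacbcabcb`. -/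
def Rw : List (Fin 3) :=
  [0,1,0,2,0,1,2,0,2,1,0,2,0,1,2,1,0,1,2,0,2,1,0,2,0,1,0,2,1,2,0,2,1,0,2,0,1,2,1,0,1,2,0,1,0,2,1,2,0,1,2,1]

/-- The word `S = acabacbabcacbacabcbacbcabacbabcacbacabcbabcacbaca`. -/
def Sw : List (Fin 3) :=
  [0,2,0,1,0,2,1,0,1,2,0,2,1,0,2,0,1,2,1,0,2,1,2,0,1,0,2,1,0,1,2,0,2,1,0,2,0,1,2,1,0,1,2,0,2,1,0,2,0]

/-- The identity permutation `()` of `Γ = {a,b,c}` (with `a = 0`, `b = 1`, `c = 2`). -/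
def pid : Equiv.Perm (Fin 3) := 1
/-- The permutation `(ab)`. -/
def pab : Equiv.Perm (Fin 3) := Equiv.swap 0 1
/-- The permutation `(ac)`. -/
def pac : Equiv.Perm (Fin 3) := Equiv.swap 0 2
/-- The permutation `(bc)`. -/
def pbc : Equiv.Perm (Fin 3) := Equiv.swap 1 2
/-- The permutation `(abc)`, i.e. `a ↦ b ↦ c ↦ a`. -/
def pabc : Equiv.Perm (Fin 3) := (Equiv.swap 0 1).trans (Equiv.swap 0 2)
/-- The permutation `(acb)`, i.e. `a ↦ c ↦ b ↦ a`. -/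
def pacb : Equiv.Perm (Fin 3) := (Equiv.swap 0 2).trans (Equiv.swap 0 1)

/-- The vertex set `V(D) = S_Γ ∪ S̃_Γ`: a permutation `π` together with a Boolean
which is `false` for the plain letter `π` and `true` for its mirror image `π̃`. -/
abbrev V : Type := Equiv.Perm (Fin 3) × Bool

/-- The 24 arcs of the digraph `D`. -/
def arcs : List (V × V) :=
  [((pid,false),(pab,true)), ((pac,true),(pid,false)), ((pab,false),(pid,true)),
   ((pacb,true),(pab,false)), ((pid,true),(pac,false)), ((pac,false),(pabc,true)),
   ((pabc,true),(pbc,false)), ((pbc,false),(pacb,true)), ((pabc,false),(pac,true)),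
   ((pbc,true),(pabc,false)), ((pab,true),(pacb,false)), ((pacb,false),(pbc,true)),
   ((pid,false),(pbc,false)), ((pbc,false),(pid,false)), ((pab,false),(pabc,false)),
   ((pabc,false),(pab,false)), ((pac,false),(pacb,false)), ((pacb,false),(pac,false)),
   ((pbc,true),(pid,true)), ((pid,true),(pbc,true)), ((pabc,true),(pab,true)),
   ((pab,true),(pabc,true)), ((pacb,true),(pac,true)), ((pac,true),(pacb,true))]

/-- The arc relation of the digraph `D`. -/
def Arc (x y : V) : Prop := (x, y) ∈ arcs

/-- For `x = (π, false)` this is `W_π` (permute letters by `π`);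
for `x = (π, true)` this is `W_π̃` (the reversal of `W_π`). -/
def applyV (x : V) (w : List (Fin 3)) : List (Fin 3) :=
  if x.2 then (w.map x.1).reverse else w.map x.1

/-- The vertex set of `D̂`: original vertices `Sum.inl x`, plus the new letters
`p_x = Sum.inr (x, false)` and `s_x = Sum.inr (x, true)`. -/
abbrev Vhat : Type := V ⊕ (V × Bool)

/-- The arc relation of the digraph `D̂`: the arcs of `D`, together with an arc
from `p_x` to `x` and an arc from `x` to `s_x`, for each vertex `x` of `D`. -/
def ArcHat : Vhat → Vhat → Prop
  | Sum.inl x, Sum.inl y => Arc x y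
  | Sum.inr (x, false), Sum.inl y => x = y
  | Sum.inl x, Sum.inr (y, true) => x = y
  | _, _ => False

/-- The unique word in `δ(p_x)`: `P_x` if `x ∈ S_Γ`, and `S_x` if `x ∈ S̃_Γ`. -/
def pword (x : V) : List (Fin 3) := applyV x (if x.2 then Sw else Pw)

/-- The unique word in `δ(s_x)`: `S_x` if `x ∈ S_Γ`, and `P_x` if `x ∈ S̃_Γ`. -/
def sword (x : V) : List (Fin 3) := applyV x (if x.2 then Pw else Sw)

/-- The substitution `δ` on the letters of `V(D̂)`. -/
def delta : Vhat → Set (List (Fin 3))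
  | Sum.inl x => {applyV x Qw, applyV x Rw}
  | Sum.inr (x, false) => {pword x}
  | Sum.inr (x, true) => {sword x}


/-! ### Squares by position, and prefixes of a suffix -/

section Words

variable {α β : Type*}

theorem prefix_drop_iff {m W : List α} {q : ℕ} :
    m <+: W.drop q ↔ ∀ j < m.length, W[q + j]? = m[j]? := by
  rw [List.prefix_iff_getElem?]
  simp only [List.getElem?_drop]
  refine forall₂_congr fun j hj => ?_
  rw [List.getElem?_eq_getElem hj]

theorem SquareFree.of_infix {u w : List α} (hw : SquareFree w) (h : u <:+: w) : SquareFree u :=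
  fun x hx hxu => hw x hx (hxu.trans h)

/-- A word is square-free iff no nonempty window agrees with the adjacent window to its right. -/
theorem squareFree_iff_getElem? {w : List α} :
    SquareFree w ↔ ∀ i p, 0 < p → i + 2 * p ≤ w.length → ∃ j < p, w[i + j]? ≠ w[i + j + p]? := by
  constructor
  · intro hw i p hp hlen
    by_contra! hper
    refine hw ((w.drop i).take p) ?_ ?_
    · intro h
      have := congrArg List.length h
      simp at this
      omega
    · refine List.IsInfix.trans (List.IsPrefix.isInfix ?_) (List.drop_suffix i w).isInfix
      rw [prefix_drop_iff]
      intro j hj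
      have hl : ((w.drop i).take p).length = p := by simp; omega
      rw [List.length_append, hl] at hj
      rcases lt_or_ge j p with h | h
      · rw [List.getElem?_append_left (by omega)]
        simp [h]
      · rw [List.getElem?_append_right (by omega), hl]
        have := hper (j - p) (by omega)
        rw [show i + (j - p) + p = i + j by omega] at this
        simp [show j - p < p by omega, this]
  · rintro h x hx ⟨s, t, rfl⟩
    obtain ⟨j, hj, hne⟩ := h s.length x.length (List.length_pos_iff.2 hx) (by simp; omega)
    apply hne
    have h := prefix_drop_iff.1
      (show x ++ x <+: (s ++ (x ++ x) ++ t).drop s.length by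
        simp [List.append_assoc])
    have h1 := h j (by simp; omega)
    have h2 := h (j + x.length) (by simp; omega)
    rw [List.getElem?_append_left hj] at h1
    rw [List.getElem?_append_right (l₁ := x) (by omega), Nat.add_sub_cancel] at h2
    rw [h1, add_assoc, h2]

theorem SquareFree.map {f : α → β} (hf : Function.Injective f) {w : List α} (hw : SquareFree w) :
    SquareFree (w.map f) := by
  rw [squareFree_iff_getElem?] at hw ⊢
  intro i p hp hlen
  obtain ⟨j, hj, hne⟩ := hw i p hp (by simpa using hlen)
  refine ⟨j, hj, fun h => hne ?_⟩
  rw [List.getElem?_map, List.getElem?_map] at h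
  exact Option.map_injective hf h

theorem suffix_take_of_prefix_drop {m W : List α} {q r : ℕ} (h : m <+: W.drop q)
    (hr : q + m.length = r) : m <:+ W.take r := by
  obtain ⟨t, ht⟩ := h
  refine ⟨W.take q, ?_⟩
  rw [← hr, List.take_add, ← ht, List.take_left]

end Words

/-! ### Square detection by bit arithmetic -/

/-- The number whose binary digits mark the positions of the letter `c`. -/
def plane (c : Fin 3) : List (Fin 3) → ℕ
  | [] => 0
  | a :: l => (bif Nat.beq a.val c.val then 1 else 0) + 2 * plane c l

theorem testBit_plane (c : Fin 3) (l : List (Fin 3)) (j : ℕ) :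
    (plane c l).testBit j = decide (l[j]? = some c) := by
  induction l generalizing j with
  | nil => simp [plane]
  | cons a l ih =>
    have hb : (Nat.beq a.val c.val) = decide (a = c) := by
      rw [Bool.eq_iff_iff]
      simp [Fin.ext_iff]
    rw [plane, hb]
    cases j with
    | zero => by_cases h : a = c <;> simp [h, Nat.testBit_zero]
    | succ j =>
      rw [Nat.testBit_succ]
      have : ((bif decide (a = c) then 1 else 0) + 2 * plane c l) / 2 = plane c l := by
        by_cases h : a = c
        · simp only [h, decide_true, cond_true]
          omega
        · simp [h]
      simp [this, ih]

theorem plane_append (c : Fin 3) (l m : List (Fin 3)) :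
    plane c (l ++ m) = plane c l + 2 ^ l.length * plane c m := by
  induction l with
  | nil => simp [plane]
  | cons a l ih => simp [plane, ih, pow_succ]; ring

theorem plane_lt (c : Fin 3) (l : List (Fin 3)) : plane c l < 2 ^ l.length := by
  induction l with
  | nil => simp [plane]
  | cons a l ih =>
    have : (bif Nat.beq a.val c.val then 1 else 0) ≤ 1 := by cases Nat.beq a.val c.val <;> simp
    simp only [plane, List.length_cons, pow_succ]
    omega

theorem plane_append_mod (c : Fin 3) (l m : List (Fin 3)) :
    plane c (l ++ m) % 2 ^ l.length = plane c l := by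
  rw [plane_append, Nat.add_mul_mod_self_left, Nat.mod_eq_of_lt (plane_lt c l)]

theorem plane_append_div (c : Fin 3) (l m : List (Fin 3)) :
    plane c (l ++ m) / 2 ^ l.length = plane c m := by
  rw [plane_append, Nat.add_mul_div_left _ _ (by positivity), Nat.div_eq_of_lt (plane_lt c l),
    zero_add]

theorem getElem?_eq_iff_plane {l : List (Fin 3)} {i j : ℕ} (hi : i < l.length)
    (hj : j < l.length) :
    l[i]? = l[j]? ↔ (plane 1 l).testBit i = (plane 1 l).testBit j ∧
      (plane 2 l).testBit i = (plane 2 l).testBit j := by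
  simp only [testBit_plane, List.getElem?_eq_getElem hi, List.getElem?_eq_getElem hj,
    Option.some.injEq]
  generalize l[i] = a
  generalize l[j] = b
  revert a b
  decide

/-- Bit `j` of `dilate m k` is set iff one of the `2 ^ k` bits of `m` from position `j` on is. -/
def dilate (m : ℕ) : ℕ → ℕ
  | 0 => m
  | k + 1 => Nat.lor (dilate m k) (Nat.shiftRight (dilate m k) (2 ^ k))

theorem testBit_lor_shiftRight (a b j : ℕ) :
    (Nat.lor a (Nat.shiftRight a b)).testBit j = (a.testBit j || a.testBit (b + j)) := by
  change (a ||| a >>> b).testBit j = _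
  rw [Nat.testBit_or, Nat.testBit_shiftRight]

theorem testBit_dilate (m k j : ℕ) :
    (dilate m k).testBit j = true ↔ ∃ i < 2 ^ k, m.testBit (j + i) = true := by
  induction k generalizing j with
  | zero => simp [dilate]
  | succ k ih =>
    rw [dilate, testBit_lor_shiftRight, Bool.or_eq_true, ih, ih, pow_succ]
    constructor
    · rintro (⟨i, hi, h⟩ | ⟨i, hi, h⟩)
      · exact ⟨i, by omega, h⟩
      · exact ⟨2 ^ k + i, by omega, by rwa [← add_assoc, add_comm j]⟩
    · rintro ⟨i, hi, h⟩
      rcases lt_or_ge i (2 ^ k) with h' | h'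
      · exact Or.inl ⟨i, h', h⟩
      · exact Or.inr ⟨i - 2 ^ k, by omega, by rwa [show 2 ^ k + j + (i - 2 ^ k) = j + i by omega]⟩

/-- Bit `j` of `windows m p` is set iff one of the `p` bits of `m` from position `j` on is. -/
def windows (m p : ℕ) : ℕ :=
  Nat.lor (dilate m (Nat.log2 p)) (Nat.shiftRight (dilate m (Nat.log2 p)) (p - 2 ^ Nat.log2 p))

theorem testBit_windows (m j : ℕ) {p : ℕ} (hp : 0 < p) :
    (windows m p).testBit j = true ↔ ∃ i < p, m.testBit (j + i) = true := by
  have h1 : 2 ^ Nat.log2 p ≤ p := Nat.log2_self_le hp.ne'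
  have h2 : p < 2 ^ (Nat.log2 p + 1) := Nat.lt_log2_self
  rw [pow_succ] at h2
  rw [windows, testBit_lor_shiftRight, Bool.or_eq_true, testBit_dilate, testBit_dilate]
  generalize 2 ^ Nat.log2 p = t at *
  constructor
  · rintro (⟨i, hi, h⟩ | ⟨i, hi, h⟩)
    · exact ⟨i, by omega, h⟩
    · exact ⟨p - t + i, by omega, by rwa [← add_assoc, add_comm j]⟩
  · rintro ⟨i, hi, h⟩
    rcases lt_or_ge i t with h' | h'
    · exact Or.inl ⟨i, h', h⟩
    · exact Or.inr ⟨i - (p - t), by omega,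
        by rwa [show p - t + j + (i - (p - t)) = j + i by omega]⟩

/-- The positions at which the word with planes `u`, `v` differs from its shift by `p`. -/
def mismatches (u v p : ℕ) : ℕ :=
  Nat.lor (Nat.xor u (Nat.shiftRight u p)) (Nat.xor v (Nat.shiftRight v p))

theorem testBit_mismatches (u v p j : ℕ) : (mismatches u v p).testBit j = true ↔
    ¬ (u.testBit j = u.testBit (j + p) ∧ v.testBit j = v.testBit (j + p)) := by
  change ((u ^^^ u >>> p) ||| (v ^^^ v >>> p)).testBit j = true ↔ _
  rw [Nat.testBit_or, Nat.testBit_xor, Nat.testBit_xor, Nat.testBit_shiftRight,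
    Nat.testBit_shiftRight, add_comm p j]
  cases u.testBit j <;> cases u.testBit (j + p) <;> cases v.testBit j <;>
    cases v.testBit (j + p) <;> decide

/-- Does the word of length `n` with planes `u`, `v` contain a square of period `p`? -/
def hasPeriod (n u v p : ℕ) : Bool :=
  !(Nat.beq (windows (mismatches u v p) p % 2 ^ (n + 1 - 2 * p)) (2 ^ (n + 1 - 2 * p) - 1))

theorem mod_two_pow_eq_sub_one_iff (x c : ℕ) :
    x % 2 ^ c = 2 ^ c - 1 ↔ ∀ j < c, x.testBit j = true := by
  constructor
  · intro h j hj
    have := congrArg (fun y => Nat.testBit y j) h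
    simpa [Nat.testBit_mod_two_pow, Nat.testBit_two_pow_sub_one, hj] using this
  · intro h
    refine Nat.eq_of_testBit_eq fun j => ?_
    rw [Nat.testBit_mod_two_pow, Nat.testBit_two_pow_sub_one]
    by_cases hj : j < c <;> simp [hj, h]

theorem hasPeriod_iff (l : List (Fin 3)) {p : ℕ} (hp : 0 < p) :
    hasPeriod l.length (plane 1 l) (plane 2 l) p = true ↔
      ∃ i, i + 2 * p ≤ l.length ∧ ∀ j < p, l[i + j]? = l[i + j + p]? := by
  rw [hasPeriod, Bool.not_eq_true', ← Bool.not_eq_true, Nat.beq_eq, mod_two_pow_eq_sub_one_iff]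
  push Not
  refine exists_congr fun i => ?_
  rw [show i < l.length + 1 - 2 * p ↔ i + 2 * p ≤ l.length by omega]
  refine and_congr_right fun hi => ?_
  rw [Ne, testBit_windows _ _ hp]
  push Not
  refine forall₂_congr fun j hj => ?_
  rw [Ne, testBit_mismatches, not_not, ← getElem?_eq_iff_plane (by omega) (by omega)]

/-- Does the word of length `n` with planes `u`, `v` contain a square of period at most `p`? -/
def hasPeriodLe (n u v p : ℕ) : Bool :=
  (List.range p).any fun q => hasPeriod n u v (q + 1)

theorem squareFree_of_hasPeriodLe {l : List (Fin 3)}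
    (h : hasPeriodLe l.length (plane 1 l) (plane 2 l) (l.length / 2) = false) :
    SquareFree l := by
  rw [squareFree_iff_getElem?]
  intro i p hp hlen
  by_contra! hper
  have := (hasPeriod_iff l hp).2 ⟨i, hlen, hper⟩
  rw [hasPeriodLe, List.any_eq_false] at h
  refine h (p - 1) (List.mem_range.2 (by omega)) ?_
  rwa [Nat.sub_add_cancel hp]

theorem not_squareFree_of_hasPeriodLe {l : List (Fin 3)} {P : ℕ}
    (h : hasPeriodLe l.length (plane 1 l) (plane 2 l) P = true) : ¬ SquareFree l := by
  rw [hasPeriodLe, List.any_eq_true] at h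
  obtain ⟨q, -, hq⟩ := h
  obtain ⟨i, hi, hper⟩ := (hasPeriod_iff l q.succ_pos).1 hq
  rw [squareFree_iff_getElem?]
  intro hsf
  obtain ⟨j, hj, hne⟩ := hsf i (q + 1) q.succ_pos hi
  exact hne (hper j hj)

/-- The plane of a word after inserting at position `g` a letter with bit `b`. -/
def insertBit (u g b : ℕ) : ℕ := u % 2 ^ g + 2 ^ g * (b + 2 * (u / 2 ^ g))

theorem plane_insert (c a : Fin 3) (l : List (Fin 3)) {g : ℕ} (hg : g ≤ l.length) :
    plane c (l.take g ++ [a] ++ l.drop g) =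
      insertBit (plane c l) g (bif Nat.beq a.val c.val then 1 else 0) := by
  have hl : (l.take g).length = g := by simpa using hg
  have h1 := plane_append_mod c (l.take g) (l.drop g)
  have h2 := plane_append_div c (l.take g) (l.drop g)
  rw [List.take_append_drop, hl] at h1 h2
  rw [insertBit, h1, h2, List.append_assoc, plane_append, hl]
  rfl

/-- Every insertion of a letter at a position in `[lo, hi]` creates a square of period at
most `P`. -/
def gapsClosed (P lo hi : ℕ) (l : List (Fin 3)) : Bool :=
  (List.range (hi + 1 - lo)).all fun r => [0, 1, 2].all fun a : Fin 3 =>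
    hasPeriodLe (l.length + 1)
      (insertBit (plane 1 l) (lo + r) (bif Nat.beq a.val (1 : Fin 3).val then 1 else 0))
      (insertBit (plane 2 l) (lo + r) (bif Nat.beq a.val (2 : Fin 3).val then 1 else 0)) P

theorem not_squareFree_insert_of_gapsClosed {P lo hi : ℕ} {l : List (Fin 3)}
    (h : gapsClosed P lo hi l = true) (hhi : hi ≤ l.length) {g : ℕ} (h1 : lo ≤ g) (h2 : g ≤ hi)
    (a : Fin 3) : ¬ SquareFree (l.take g ++ [a] ++ l.drop g) := by
  rw [gapsClosed, List.all_eq_true] at h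
  have h := h (g - lo) (List.mem_range.2 (by omega))
  rw [List.all_eq_true] at h
  have h := h a (by revert a; decide)
  rw [show lo + (g - lo) = g by omega, ← plane_insert 1 a l (by omega),
    ← plane_insert 2 a l (by omega)] at h
  refine not_squareFree_of_hasPeriodLe (P := P) ?_
  convert h using 2
  simp
  omega

/-! ### Blocks and their finitely many local properties -/

/-- A vertex of the extended digraph with a choice of the word substituted for it. -/
abbrev Block : Type := Vhat × Bool

/-- The word substituted for a block: the flag selects between `Q` and `R`. -/
def blockWord : Block → List (Fin 3)
  | (Sum.inl x, false) => applyV x Qw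
  | (Sum.inl x, true) => applyV x Rw
  | (Sum.inr (x, false), _) => pword x
  | (Sum.inr (x, true), _) => sword x

/-- The possible successors of a vertex of the extended digraph. -/
def succs : Vhat → List Vhat
  | Sum.inl (π, false) =>
    [Sum.inl (π * pab, true), Sum.inl (π * pbc, false), Sum.inr ((π, false), true)]
  | Sum.inl (π, true) =>
    [Sum.inl (π * pac, false), Sum.inl (π * pbc, true), Sum.inr ((π, true), true)]
  | Sum.inr (x, false) => [Sum.inl x]
  | Sum.inr (_, true) => []

/-- The possible predecessors of a vertex of the extended digraph. -/
def preds : Vhat → List Vhat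
  | Sum.inl (π, false) =>
    [Sum.inl (π * pac, true), Sum.inl (π * pbc, false), Sum.inr ((π, false), false)]
  | Sum.inl (π, true) =>
    [Sum.inl (π * pab, false), Sum.inl (π * pbc, true), Sum.inr ((π, true), false)]
  | Sum.inr (_, false) => []
  | Sum.inr (x, true) => [Sum.inl x]

theorem arcs_mem_succs : ∀ a ∈ arcs, Sum.inl a.2 ∈ succs (Sum.inl a.1) := by
  have h : ∀ a ∈ arcs, a.2 = (a.1.1 * bif a.1.2 then pac else pab, !a.1.2) ∨
      a.2 = (a.1.1 * pbc, a.1.2) := by decide +kernel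
  rintro ⟨⟨π, _ | _⟩, y⟩ ha <;> rcases h _ ha with h | h <;> simp_all [succs]

theorem arcs_mem_preds : ∀ a ∈ arcs, Sum.inl a.1 ∈ preds (Sum.inl a.2) := by
  have h : ∀ a ∈ arcs, a.1 = (a.2.1 * bif a.2.2 then pab else pac, !a.2.2) ∨
      a.1 = (a.2.1 * pbc, a.2.2) := by decide +kernel
  rintro ⟨x, ⟨π, _ | _⟩⟩ ha <;> rcases h _ ha with h | h <;> simp_all [preds]

theorem ArcHat.mem_succs {a b : Vhat} (h : ArcHat a b) : b ∈ succs a := by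
  match a, b, h with
  | Sum.inl x, Sum.inl y, h => exact arcs_mem_succs (x, y) h
  | Sum.inr (x, false), Sum.inl y, h => exact List.mem_singleton.2 (congrArg Sum.inl h.symm)
  | Sum.inl (π, false), Sum.inr (y, true), h => obtain rfl : (π, false) = y := h; simp [succs]
  | Sum.inl (π, true), Sum.inr (y, true), h => obtain rfl : (π, true) = y := h; simp [succs]

theorem ArcHat.mem_preds {a b : Vhat} (h : ArcHat a b) : a ∈ preds b := by
  match a, b, h with
  | Sum.inl x, Sum.inl y, h => exact arcs_mem_preds (x, y) h
  | Sum.inl x, Sum.inr (y, true), h => exact List.mem_singleton.2 (congrArg Sum.inl h)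
  | Sum.inr (x, false), Sum.inl (π, false), h =>
    obtain rfl : x = (π, false) := h; simp [preds]
  | Sum.inr (x, false), Sum.inl (π, true), h => obtain rfl : x = (π, true) := h; simp [preds]

/-- Permuting the letters of `Γ` acts on the vertices of the extended digraph. -/
def act (σ : Equiv.Perm (Fin 3)) : Vhat → Vhat
  | Sum.inl (π, m) => Sum.inl (σ * π, m)
  | Sum.inr ((π, m), e) => Sum.inr ((σ * π, m), e)

theorem succs_act (σ : Equiv.Perm (Fin 3)) (a : Vhat) :
    succs (act σ a) = (succs a).map (act σ) := by
  rcases a with ⟨π, _ | _⟩ | ⟨⟨π, m⟩, _ | _⟩ <;> simp [succs, act, mul_assoc]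

theorem preds_act (σ : Equiv.Perm (Fin 3)) (a : Vhat) :
    preds (act σ a) = (preds a).map (act σ) := by
  rcases a with ⟨π, _ | _⟩ | ⟨⟨π, m⟩, _ | _⟩ <;> simp [preds, act, mul_assoc]

theorem applyV_mul (σ π : Equiv.Perm (Fin 3)) (m : Bool) (w : List (Fin 3)) :
    applyV (σ * π, m) w = (applyV (π, m) w).map σ := by
  cases m <;> simp [applyV, Function.comp_def]

theorem blockWord_act (σ : Equiv.Perm (Fin 3)) (a : Vhat) (i : Bool) :
    blockWord (act σ a, i) = (blockWord (a, i)).map σ := by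
  rcases a with ⟨π, m⟩ | ⟨⟨π, m⟩, _ | _⟩ <;> cases i <;>
    simp only [blockWord, act, pword, sword, applyV_mul]

/-- Representatives of the orbits of the action of the letter permutations. -/
def canonical : List Vhat :=
  [Sum.inl (1, false), Sum.inl (1, true), Sum.inr ((1, false), false), Sum.inr ((1, true), false),
    Sum.inr ((1, false), true), Sum.inr ((1, true), true)]

theorem exists_canonical (a : Vhat) : ∃ σ, ∃ a₀ ∈ canonical, a = act σ a₀ := by
  rcases a with ⟨π, m⟩ | ⟨⟨π, m⟩, e⟩
  · exact ⟨π, Sum.inl (1, m), by cases m <;> simp [canonical], by simp [act]⟩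
  · exact ⟨π, Sum.inr ((1, m), e), by cases m <;> cases e <;> simp [canonical], by simp [act]⟩

theorem mem_bools (i : Bool) : i ∈ [false, true] := by cases i <;> simp

/-- Any three consecutive blocks form a square-free word. -/
def triplesSquareFree : Bool :=
  canonical.all fun a => (succs a).all fun b => (succs b).all fun c =>
    [false, true].all fun i => [false, true].all fun j => [false, true].all fun k =>
      let l := blockWord (a, i) ++ (blockWord (b, j) ++ blockWord (c, k))
      !hasPeriodLe l.length (plane 1 l) (plane 2 l) (l.length / 2)

theorem triplesSquareFree_eq_true : triplesSquareFree = true := by decide +kernel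

theorem squareFree_triple {a b c : Block} (hab : ArcHat a.1 b.1) (hbc : ArcHat b.1 c.1) :
    SquareFree (blockWord a ++ (blockWord b ++ blockWord c)) := by
  obtain ⟨a, i⟩ := a
  obtain ⟨b, j⟩ := b
  obtain ⟨c, k⟩ := c
  obtain ⟨σ, a₀, ha, rfl⟩ := exists_canonical a
  have hb := hab.mem_succs
  have hc := hbc.mem_succs
  simp only [succs_act, List.mem_map] at hb
  obtain ⟨b₀, hb, rfl⟩ := hb
  simp only [succs_act, List.mem_map] at hc
  obtain ⟨c₀, hc, rfl⟩ := hc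
  simp only [blockWord_act, ← List.map_append]
  refine SquareFree.map σ.injective (squareFree_of_hasPeriodLe ?_)
  have h := triplesSquareFree_eq_true
  simp only [triplesSquareFree, List.all_eq_true, Bool.not_eq_true'] at h
  exact h a₀ ha b₀ hb c₀ hc i (mem_bools i) j (mem_bools j) k (mem_bools k)

/-- Is this one of the additional vertices of the extended digraph? -/
def isEnd : Vhat → Bool
  | Sum.inl _ => false
  | Sum.inr _ => true

theorem isEnd_act (σ : Equiv.Perm (Fin 3)) (a : Vhat) : isEnd (act σ a) = isEnd a := by
  rcases a with ⟨π, m⟩ | ⟨⟨π, m⟩, e⟩ <;> rfl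

/-- In two consecutive blocks, every insertion between the letters of the first block, at the
junction, or at the outer side of an end block, creates a square. -/
def pairsClosed : Bool :=
  canonical.all fun a => (succs a).all fun b =>
    [false, true].all fun i => [false, true].all fun j =>
      gapsClosed 23 (bif isEnd a then 0 else 1)
        ((blockWord (a, i)).length + bif isEnd b then (blockWord (b, j)).length else 0)
        (blockWord (a, i) ++ blockWord (b, j))

theorem pairsClosed_eq_true : pairsClosed = true := by decide +kernel

theorem not_squareFree_insert_pair {a b : Block} (hab : ArcHat a.1 b.1) {g : ℕ}
    (h1 : (bif isEnd a.1 then 0 else 1) ≤ g)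
    (h2 : g ≤ (blockWord a).length + bif isEnd b.1 then (blockWord b).length else 0)
    (x : Fin 3) :
    ¬ SquareFree ((blockWord a ++ blockWord b).take g ++ [x] ++
      (blockWord a ++ blockWord b).drop g) := by
  obtain ⟨a, i⟩ := a
  obtain ⟨b, j⟩ := b
  obtain ⟨σ, a₀, ha, rfl⟩ := exists_canonical a
  have hb := hab.mem_succs
  simp only [succs_act, List.mem_map] at hb
  obtain ⟨b₀, hb, rfl⟩ := hb
  simp only [isEnd_act, blockWord_act, List.length_map] at h1 h2
  have h := pairsClosed_eq_true
  simp only [pairsClosed, List.all_eq_true] at h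
  have h := not_squareFree_insert_of_gapsClosed
    (h a₀ ha b₀ hb i (mem_bools i) j (mem_bools j))
    (by rw [List.length_append]; cases isEnd b₀ <;> simp) h1 h2 (σ⁻¹ x)
  intro hsf
  apply h
  have := hsf.map (f := ⇑σ⁻¹) (σ⁻¹).injective
  simpa [blockWord_act, Function.comp_def] using this

/-- The marker `M = bcacbacabcbabcaba` common to `Q` and `R`. -/
def markerWord : List (Fin 3) := (Qw.drop 16).take 17

/-- The marker contained in the two words substituted for a vertex. -/
def marker (z : V) : List (Fin 3) := applyV z markerWord

/-- The position of the marker in a block. -/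
def offset : Block → ℕ
  | (Sum.inl (_, false), false) => 16
  | (Sum.inl (_, false), true) => 27
  | _ => 8

theorem length_marker (z : V) : (marker z).length = 17 := by
  unfold marker applyV
  split <;> simp [markerWord, Qw]

theorem length_blockWord (a : Block) : 41 ≤ (blockWord a).length := by
  rcases a with ⟨⟨π, _ | _⟩ | ⟨⟨π, _ | _⟩, _ | _⟩, _ | _⟩ <;>
    simp [blockWord, pword, sword, applyV, Pw, Qw, Rw, Sw]

theorem offset_add_le (a : Block) : offset a + 17 ≤ (blockWord a).length := by
  have := length_blockWord a
  rcases a with ⟨⟨π, _ | _⟩ | ⟨⟨π, _ | _⟩, _ | _⟩, _ | _⟩ <;>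
    simp [offset, blockWord, pword, sword, applyV, Pw, Qw, Rw, Sw]

theorem offset_act (σ : Equiv.Perm (Fin 3)) (a : Vhat) (i : Bool) :
    offset (act σ a, i) = offset (a, i) := by
  rcases a with ⟨π, _ | _⟩ | ⟨⟨π, m⟩, e⟩ <;> cases i <;> rfl

theorem marker_prefix (z : V) (i : Bool) :
    marker z <+: (blockWord (Sum.inl z, i)).drop (offset (Sum.inl z, i)) := by
  obtain ⟨π, m⟩ := z
  rw [← mul_one π]
  change marker (π * 1, m) <+: (blockWord (act π (Sum.inl (1, m)), i)).drop
    (offset (act π (Sum.inl (1, m)), i))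
  rw [blockWord_act, offset_act, marker, applyV_mul, ← List.map_drop]
  refine List.IsPrefix.map _ ?_
  cases m <;> cases i <;> decide

/-- The list of all letter permutations. -/
def perms : List (Equiv.Perm (Fin 3)) := [pid, pab, pac, pbc, pabc, pacb]

theorem mem_perms (π : Equiv.Perm (Fin 3)) : π ∈ perms := by
  revert π
  decide +kernel

/-- The word with planes `u`, `v` has the word with planes `u'`, `v'` of length `n` at
position `r`. -/
def occursAt (u v u' v' n r : ℕ) : Bool :=
  Nat.beq (u / 2 ^ r % 2 ^ n) u' && Nat.beq (v / 2 ^ r % 2 ^ n) v'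

theorem plane_div_mod_of_prefix_drop {m l : List (Fin 3)} {r : ℕ} (h : m <+: l.drop r)
    (hr : r ≤ l.length) (c : Fin 3) : plane c l / 2 ^ r % 2 ^ m.length = plane c m := by
  obtain ⟨t, ht⟩ := h
  have h := plane_append_div c (l.take r) (l.drop r)
  rw [List.take_append_drop, List.length_take_of_le hr] at h
  rw [h, ← ht, plane_append_mod]

theorem occursAt_of_prefix_drop {m l : List (Fin 3)} {r : ℕ} (h : m <+: l.drop r)
    (hr : r ≤ l.length) :
    occursAt (plane 1 l) (plane 2 l) (plane 1 m) (plane 2 m) m.length r = true := by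
  simp [occursAt, plane_div_mod_of_prefix_drop h hr]

/-- In `l`, a marker starts at a position below `n` only if it is the one of the block `a`. -/
def markersUnique (a : Block) (n : ℕ) (l : List (Fin 3)) : Bool :=
  perms.all fun π => [false, true].all fun m => (List.range n).all fun r =>
    bif occursAt (plane 1 l) (plane 2 l) (plane 1 (marker (π, m))) (plane 2 (marker (π, m))) 17 r
    then decide (a.1 = Sum.inl (π, m)) && Nat.beq r (offset a) else true

theorem eq_of_markersUnique {a : Block} {n : ℕ} {l : List (Fin 3)}
    (h : markersUnique a n l = true) (hn : n ≤ l.length) {z : V} {r : ℕ} (hr : r < n)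
    (hz : marker z <+: l.drop r) : a.1 = Sum.inl z ∧ r = offset a := by
  simp only [markersUnique, List.all_eq_true] at h
  have h := h z.1 (mem_perms _) z.2 (mem_bools _) r (List.mem_range.2 hr)
  have ho := occursAt_of_prefix_drop hz (by omega)
  rw [length_marker] at ho
  rw [ho] at h
  simpa using h

/-- Markers are unique in pairs of consecutive blocks and in end blocks. -/
def blocksMarkersUnique : Bool :=
  canonical.all fun a => [false, true].all fun i =>
    markersUnique (a, i) (bif isEnd a then (blockWord (a, i)).length else 0) (blockWord (a, i)) &&
    (succs a).all fun b => [false, true].all fun j =>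
      markersUnique (a, i) (blockWord (a, i)).length (blockWord (a, i) ++ blockWord (b, j))

theorem blocksMarkersUnique_eq_true : blocksMarkersUnique = true := by decide +kernel

theorem marker_mul (σ π : Equiv.Perm (Fin 3)) (m : Bool) :
    marker (σ * π, m) = (marker (π, m)).map σ :=
  applyV_mul σ π m _

theorem eq_offset_of_marker_prefix {a b : Block} (hab : ArcHat a.1 b.1) {z : V} {r : ℕ}
    (hr : r < (blockWord a).length)
    (hz : marker z <+: (blockWord a ++ blockWord b).drop r) : a.1 = Sum.inl z ∧ r = offset a := by
  obtain ⟨a, i⟩ := a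
  obtain ⟨b, j⟩ := b
  obtain ⟨π, m⟩ := z
  obtain ⟨σ, a₀, ha, rfl⟩ := exists_canonical a
  have hb := hab.mem_succs
  simp only [succs_act, List.mem_map] at hb
  obtain ⟨b₀, hb, rfl⟩ := hb
  have h := blocksMarkersUnique_eq_true
  simp only [blocksMarkersUnique, List.all_eq_true, Bool.and_eq_true] at h
  have h := (h a₀ ha i (mem_bools i)).2 b₀ hb j (mem_bools j)
  have hz := hz.map (σ⁻¹ : Equiv.Perm (Fin 3))
  rw [← marker_mul, blockWord_act, blockWord_act, ← List.map_append, List.map_drop, List.map_map,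
    ← Equiv.Perm.coe_mul, inv_mul_cancel, Equiv.Perm.coe_one, List.map_id] at hz
  rw [blockWord_act, List.length_map] at hr
  obtain ⟨h1, h2⟩ := eq_of_markersUnique h (by simp) hr hz
  simp only at h1
  exact ⟨by simp [h1, act], by rw [offset_act, h2]⟩

theorem not_marker_prefix_of_isEnd {a : Block} (ha : isEnd a.1 = true) {z : V} {r : ℕ} :
    ¬ marker z <+: (blockWord a).drop r := by
  intro hz
  have hr : r < (blockWord a).length := by
    have := hz.length_le
    rw [length_marker, List.length_drop] at this
    omega
  obtain ⟨a, i⟩ := a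
  obtain ⟨π, m⟩ := z
  obtain ⟨σ, a₀, ha₀, rfl⟩ := exists_canonical a
  have h := blocksMarkersUnique_eq_true
  simp only [blocksMarkersUnique, List.all_eq_true, Bool.and_eq_true] at h
  have h := (h a₀ ha₀ i (mem_bools i)).1
  rw [isEnd_act] at ha
  rw [ha, cond_true] at h
  have hz := hz.map (σ⁻¹ : Equiv.Perm (Fin 3))
  rw [← marker_mul, blockWord_act, List.map_drop, List.map_map,
    ← Equiv.Perm.coe_mul, inv_mul_cancel, Equiv.Perm.coe_one, List.map_id] at hz
  rw [blockWord_act, List.length_map] at hr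
  obtain ⟨h1, -⟩ := eq_of_markersUnique h le_rfl hr hz
  simp only at h1
  simp [h1, isEnd] at ha

/-- Is one of the two words a prefix of the other? -/
def comparable (l m : List (Fin 3)) : Bool := l.isPrefixOf m || m.isPrefixOf l

theorem comparable_of_prefix {l m W : List (Fin 3)} (h1 : l <+: W) (h2 : m <+: W) :
    comparable l m = true := by
  simpa [comparable] using List.prefix_or_prefix_of_prefix h1 h2

theorem comparable_map {l m : List (Fin 3)} (σ : Equiv.Perm (Fin 3)) :
    comparable (l.map σ) (m.map σ) = comparable l m := by
  have : ∀ l m : List (Fin 3), l.map σ <+: m.map σ ↔ l <+: m := fun l m =>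
    List.prefix_map_iff_of_injective σ.injective
  rw [Bool.eq_iff_iff]
  simp [comparable, this]

/-- A block from its marker on, together with 21 letters of the next block, determines the next
vertex. -/
def succsDetermined : Bool :=
  [Sum.inl (1, false), Sum.inl (1, true)].all fun c => (succs c).all fun a => (succs c).all fun b =>
    [false, true].all fun i => [false, true].all fun j => [false, true].all fun k =>
      [false, true].all fun l =>
        decide (a = b) || !comparable
          ((blockWord (c, i)).drop (offset (c, i)) ++ (blockWord (a, j)).take 21)
          ((blockWord (c, k)).drop (offset (c, k)) ++ blockWord (b, l))

theorem succsDetermined_eq_true : succsDetermined = true := by decide +kernel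

/-- A block up to the end of its marker, together with 21 letters of the previous block, determines
the previous vertex. -/
def predsDetermined : Bool :=
  [Sum.inl (1, false), Sum.inl (1, true)].all fun c => (preds c).all fun a => (preds c).all fun b =>
    [false, true].all fun i => [false, true].all fun j => [false, true].all fun k =>
      [false, true].all fun l =>
        decide (a = b) || !comparable
          (((blockWord (a, j)).drop ((blockWord (a, j)).length - 21) ++
            (blockWord (c, i)).take (offset (c, i) + 17)).reverse)
          ((blockWord (b, l) ++ (blockWord (c, k)).take (offset (c, k) + 17)).reverse)

theorem predsDetermined_eq_true : predsDetermined = true := by decide +kernel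

theorem exists_canonical_inl (z : V) :
    ∃ σ, ∃ c ∈ [Sum.inl (1, false), Sum.inl (1, true)], (Sum.inl z : Vhat) = act σ c := by
  obtain ⟨π, m⟩ := z
  exact ⟨π, Sum.inl (1, m), by cases m <;> simp, by simp [act]⟩

theorem succ_eq_of_prefix {c c' a b : Block} {z : V} (hc : c.1 = Sum.inl z) (hc' : c'.1 = Sum.inl z)
    (hca : ArcHat c.1 a.1) (hcb : ArcHat c'.1 b.1) {W : List (Fin 3)}
    (h1 : (blockWord c).drop (offset c) ++ (blockWord a).take 21 <+: W)
    (h2 : (blockWord c').drop (offset c') ++ blockWord b <+: W) : a.1 = b.1 := by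
  obtain ⟨c, i⟩ := c
  obtain ⟨c', k⟩ := c'
  obtain ⟨a, j⟩ := a
  obtain ⟨b, l⟩ := b
  simp only at hc hc' hca hcb ⊢
  obtain ⟨σ, c₀, hc₀, hz⟩ := exists_canonical_inl z
  obtain rfl : c = act σ c₀ := hc.trans hz
  obtain rfl : c' = act σ c₀ := hc'.trans hz
  have ha := hca.mem_succs
  have hb := hcb.mem_succs
  simp only [succs_act, List.mem_map] at ha hb
  obtain ⟨a₀, ha, rfl⟩ := ha
  obtain ⟨b₀, hb, rfl⟩ := hb
  have h := succsDetermined_eq_true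
  simp only [succsDetermined, List.all_eq_true] at h
  have h := h c₀ hc₀ a₀ ha b₀ hb i (mem_bools i) j (mem_bools j) k (mem_bools k) l (mem_bools l)
  rw [← comparable_map σ] at h
  simp only [List.map_append, List.map_drop, List.map_take, ← blockWord_act] at h
  rw [← offset_act σ c₀ i, ← offset_act σ c₀ k, comparable_of_prefix h1 h2, Bool.not_true,
    Bool.or_false, decide_eq_true_eq] at h
  rw [h]

theorem pred_eq_of_suffix {c c' a b : Block} {z : V} (hc : c.1 = Sum.inl z) (hc' : c'.1 = Sum.inl z)
    (hac : ArcHat a.1 c.1) (hbc : ArcHat b.1 c'.1) {W : List (Fin 3)}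
    (h1 : (blockWord a).drop ((blockWord a).length - 21) ++
      (blockWord c).take (offset c + 17) <:+ W)
    (h2 : blockWord b ++ (blockWord c').take (offset c' + 17) <:+ W) : a.1 = b.1 := by
  obtain ⟨c, i⟩ := c
  obtain ⟨c', k⟩ := c'
  obtain ⟨a, j⟩ := a
  obtain ⟨b, l⟩ := b
  simp only at hc hc' hac hbc ⊢
  obtain ⟨σ, c₀, hc₀, hz⟩ := exists_canonical_inl z
  obtain rfl : c = act σ c₀ := hc.trans hz
  obtain rfl : c' = act σ c₀ := hc'.trans hz
  have ha := hac.mem_preds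
  have hb := hbc.mem_preds
  simp only [preds_act, List.mem_map] at ha hb
  obtain ⟨a₀, ha, rfl⟩ := ha
  obtain ⟨b₀, hb, rfl⟩ := hb
  have h := predsDetermined_eq_true
  simp only [predsDetermined, List.all_eq_true] at h
  have h := h c₀ hc₀ a₀ ha b₀ hb i (mem_bools i) j (mem_bools j) k (mem_bools k) l (mem_bools l)
  rw [← comparable_map σ] at h
  simp only [List.map_reverse, List.map_append, List.map_drop, List.map_take, ← blockWord_act] at h
  rw [← offset_act σ c₀ i, ← offset_act σ c₀ k,
    show (blockWord (a₀, j)).length = (blockWord (act σ a₀, j)).length by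
      rw [blockWord_act, List.length_map],
    comparable_of_prefix (List.reverse_prefix.2 h1) (List.reverse_prefix.2 h2), Bool.not_true,
    Bool.or_false, decide_eq_true_eq] at h
  rw [h]

/-! ### Words composed of blocks -/

section Blocks

/-- The concatenation of the words of a list of blocks. -/
def flat (L : List Block) : List (Fin 3) := L.flatMap blockWord

/-- The block with index `k`. -/
def blk (L : List Block) (k : ℕ) : Block := L.getD k default

/-- The position in `flat L` at which the block with index `k` starts. -/
def pos (L : List Block) (k : ℕ) : ℕ := (flat (L.take k)).length

/-- The position in `flat L` of the marker of the block with index `k`. -/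
def mark (L : List Block) (k : ℕ) : ℕ := pos L k + offset (blk L k)

variable {L : List Block}

theorem drop_pos (k : ℕ) : (flat L).drop (pos L k) = flat (L.drop k) := by
  have h : flat L = flat (L.take k) ++ flat (L.drop k) := by
    rw [flat, flat, flat, ← List.flatMap_append, List.take_append_drop]
  rw [h, pos, List.drop_left]

theorem blk_eq {k : ℕ} (hk : k < L.length) : blk L k = L[k] := by
  simp [blk, hk]

theorem drop_pos_eq_append {k : ℕ} (hk : k < L.length) :
    (flat L).drop (pos L k) = blockWord (blk L k) ++ (flat L).drop (pos L (k + 1)) := by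
  rw [drop_pos, drop_pos, List.drop_eq_getElem_cons hk, blk_eq hk]
  rfl

theorem pos_succ {k : ℕ} (hk : k < L.length) :
    pos L (k + 1) = pos L k + (blockWord (blk L k)).length := by
  rw [pos, pos, List.take_succ_eq_append_getElem hk, blk_eq hk, flat, List.flatMap_append,
    List.length_append, List.flatMap_singleton, flat]

theorem pos_zero : pos L 0 = 0 := rfl

theorem pos_length : pos L L.length = (flat L).length := by simp [pos]

theorem pos_mono {j k : ℕ} (h : j ≤ k) : pos L j ≤ pos L k := by
  have h1 : flat (L.take j) <+: flat (L.take k) := by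
    obtain ⟨t, ht⟩ := List.take_prefix_take_left (l := L) h
    exact ⟨flat t, by rw [flat, flat, flat, ← List.flatMap_append, ht]⟩
  exact h1.length_le

theorem mark_add_le {j k : ℕ} (hj : j < L.length) (h : j < k) : mark L j + 17 ≤ pos L k := by
  have h1 := pos_mono (L := L) (show j + 1 ≤ k from h)
  have h2 := pos_succ hj
  have h3 := offset_add_le (blk L j)
  rw [mark]
  omega

theorem pos_le_mark (k : ℕ) : pos L k ≤ mark L k := Nat.le_add_right _ _

theorem lt_of_mark_lt {j k : ℕ} (hk : k < L.length) (h : mark L j < mark L k) : j < k := by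
  by_contra! hkj
  rcases hkj.eq_or_lt with rfl | hkj
  · omega
  · have := mark_add_le hk hkj
    have := pos_le_mark (L := L) j
    omega

theorem exists_block_of_lt {q : ℕ} (hq : q < (flat L).length) :
    ∃ k < L.length, pos L k ≤ q ∧ q < pos L (k + 1) := by
  have hex : ∃ k, q < pos L (k + 1) :=
    ⟨L.length, lt_of_lt_of_le (by rwa [pos_length]) (pos_mono (Nat.le_succ _))⟩
  classical
  have hle : pos L (Nat.find hex) ≤ q := by
    rcases Nat.eq_zero_or_pos (Nat.find hex) with h | h
    · rw [h, pos_zero]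
      exact Nat.zero_le _
    · have := Nat.find_min hex (Nat.sub_lt h Nat.one_pos)
      rw [Nat.sub_add_cancel (show 1 ≤ Nat.find hex from h)] at this
      omega
  refine ⟨Nat.find hex, ?_, hle, Nat.find_spec hex⟩
  by_contra! h
  have := pos_mono (L := L) h
  rw [pos_length] at this
  omega

/-- A square-free walk of at least four vertices in the extended digraph, from an initial to a
final additional vertex, with a choice of the substituted words. -/
structure IsBlockWalk (L : List Block) : Prop where
  arc : ∀ k, k + 1 < L.length → ArcHat (blk L k).1 (blk L (k + 1)).1
  isEnd_iff : ∀ k < L.length, isEnd (blk L k).1 = true ↔ k = 0 ∨ k + 1 = L.length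
  squareFree : SquareFree (L.map Prod.fst)
  four_le : 4 ≤ L.length

theorem IsBlockWalk.exists_ne (hL : IsBlockWalk L) {s d : ℕ} (hd : 0 < d)
    (h : s + 2 * d ≤ L.length) :
    ∃ j < d, (blk L (s + j)).1 ≠ (blk L (s + d + j)).1 := by
  obtain ⟨j, hj, hne⟩ := squareFree_iff_getElem?.1 hL.squareFree s d hd (by simpa using h)
  refine ⟨j, hj, fun heq => hne ?_⟩
  rw [blk_eq (by omega), blk_eq (by omega)] at heq
  rw [List.getElem?_map, List.getElem?_map, List.getElem?_eq_getElem (by omega),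
    List.getElem?_eq_getElem (by omega), Option.map_some, Option.map_some, heq]
  simp only [Nat.add_right_comm]

theorem IsBlockWalk.exists_marker (hL : IsBlockWalk L) {k : ℕ} (h0 : 0 < k)
    (hk : k + 1 < L.length) :
    ∃ z, (blk L k).1 = Sum.inl z ∧ marker z <+: (flat L).drop (mark L k) := by
  have hend := hL.isEnd_iff k (by omega)
  have hm := drop_pos_eq_append (L := L) (k := k) (by omega)
  have hle := offset_add_le (blk L k)
  rw [mark]
  rcases hb : blk L k with ⟨z | z, i⟩
  · rw [hb] at hm hle
    refine ⟨z, rfl, ?_⟩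
    rw [← List.drop_drop, hm, List.drop_append_of_le_length (by omega)]
    exact (marker_prefix z i).trans (List.prefix_append _ _)
  · rw [hb] at hend
    simp only [isEnd, true_iff] at hend
    omega

theorem IsBlockWalk.exists_mark_eq (hL : IsBlockWalk L) {z : V} {q : ℕ}
    (hz : marker z <+: (flat L).drop q) :
    ∃ k, 0 < k ∧ k + 1 < L.length ∧ (blk L k).1 = Sum.inl z ∧ mark L k = q := by
  have hlen := hz.length_le
  rw [length_marker, List.length_drop] at hlen
  obtain ⟨k, hk, h1, h2⟩ := exists_block_of_lt (L := L) (q := q) (by omega)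
  have hpos := pos_succ hk
  have hd : (flat L).drop q =
      (blockWord (blk L k) ++ (flat L).drop (pos L (k + 1))).drop (q - pos L k) := by
    rw [← drop_pos_eq_append hk, List.drop_drop, Nat.add_sub_cancel' h1]
  rw [hd] at hz
  rcases Nat.lt_or_ge (k + 1) L.length with hk1 | hk1
  · rw [drop_pos_eq_append hk1, ← List.append_assoc,
      List.drop_append_of_le_length (by rw [List.length_append]; omega)] at hz
    have hb := length_blockWord (blk L (k + 1))
    obtain ⟨h3, h4⟩ := eq_offset_of_marker_prefix (hL.arc k hk1) (by omega)
      (List.prefix_of_prefix_length_le hz (List.prefix_append _ _)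
        (by rw [length_marker, List.length_drop, List.length_append]; omega))
    have hend := hL.isEnd_iff k hk
    rw [h3] at hend
    simp only [isEnd, Bool.false_eq_true, false_iff, not_or] at hend
    exact ⟨k, by omega, by omega, h3, by rw [mark]; omega⟩
  · rw [show k + 1 = L.length by omega, pos_length, List.drop_length, List.append_nil] at hz
    exact absurd hz (not_marker_prefix_of_isEnd ((hL.isEnd_iff k hk).2 (Or.inr (by omega))))

theorem IsBlockWalk.squareFree_window (hL : IsBlockWalk L) {b : ℕ}
    (hb : b + 3 ≤ L.length) {i p : ℕ} (hp : 0 < p) (h1 : pos L b ≤ i)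
    (h2 : i + 2 * p ≤ pos L (b + 1 + 1 + 1)) :
    ∃ j < p, (flat L)[i + j]? ≠ (flat L)[i + j + p]? := by
  have hsf := squareFree_triple (hL.arc b (by omega)) (hL.arc (b + 1) (by omega))
  have hp0 := pos_succ (L := L) (k := b) (by omega)
  have hp1 := pos_succ (L := L) (k := b + 1) (by omega)
  have hp2 := pos_succ (L := L) (k := b + 1 + 1) (by omega)
  have hd := drop_pos_eq_append (L := L) (k := b) (by omega)
  rw [drop_pos_eq_append (L := L) (k := b + 1) (by omega),
    drop_pos_eq_append (L := L) (k := b + 1 + 1) (by omega),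
    ← List.append_assoc (blockWord (blk L (b + 1))),
    ← List.append_assoc] at hd
  have hget := prefix_drop_iff.1 (show _ <+: (flat L).drop (pos L b) from ⟨_, hd.symm⟩)
  obtain ⟨j, hj, hne⟩ := squareFree_iff_getElem?.1 hsf (i - pos L b) p hp
    (by simp only [List.length_append]; omega)
  refine ⟨j, hj, ?_⟩
  have e1 := hget (i - pos L b + j) (by simp only [List.length_append]; omega)
  have e2 := hget (i - pos L b + j + p) (by simp only [List.length_append]; omega)
  rw [show pos L b + (i - pos L b + j) = i + j by omega] at e1
  rw [show pos L b + (i - pos L b + j + p) = i + j + p by omega] at e2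
  rwa [e1, e2]

end Blocks

/-! ### Square-freeness -/

section Periods

variable {α : Type*} {W : List α} {i p : ℕ}

theorem prefix_drop_add_iff (hper : ∀ j < p, W[i + j]? = W[i + j + p]?) {m : List α} {q : ℕ}
    (h1 : i ≤ q) (h2 : q + m.length ≤ i + p) : m <+: W.drop (q + p) ↔ m <+: W.drop q := by
  rw [prefix_drop_iff, prefix_drop_iff]
  refine forall₂_congr fun j hj => ?_
  have := hper (q + j - i) (by omega)
  rw [show i + (q + j - i) = q + j by omega] at this
  rw [this, add_right_comm]

end Periods

section SquareFreeness

variable {L : List Block}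

/-- The marker of the inner block with index `k` lies between the positions `i` and `j`. -/
structure MarkerIn (L : List Block) (i j k : ℕ) : Prop where
  pos : 0 < k
  lt : k + 1 < L.length
  le_mark : i ≤ mark L k
  mark_le : mark L k + 17 ≤ j

variable {i p : ℕ}

theorem IsBlockWalk.exists_shift (hL : IsBlockWalk L)
    (hper : ∀ j < p, (flat L)[i + j]? = (flat L)[i + j + p]?) {k : ℕ}
    (hk : MarkerIn L i (i + p) k) :
    ∃ k', MarkerIn L (i + p) (i + 2 * p) k' ∧ mark L k' = mark L k + p ∧
      (blk L k').1 = (blk L k).1 := by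
  obtain ⟨h0, h1, h2, h3⟩ := hk
  obtain ⟨z, hz, hm⟩ := hL.exists_marker h0 h1
  rw [← prefix_drop_add_iff hper h2 (by rwa [length_marker])] at hm
  obtain ⟨k', h4, h5, h6, h7⟩ := hL.exists_mark_eq hm
  exact ⟨k', ⟨h4, h5, by omega, by omega⟩, h7, h6.trans hz.symm⟩

theorem IsBlockWalk.exists_unshift (hL : IsBlockWalk L)
    (hper : ∀ j < p, (flat L)[i + j]? = (flat L)[i + j + p]?) {k : ℕ}
    (hk : MarkerIn L (i + p) (i + 2 * p) k) :
    ∃ k', MarkerIn L i (i + p) k' ∧ mark L k = mark L k' + p := by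
  obtain ⟨h0, h1, h2, h3⟩ := hk
  obtain ⟨z, hz, hm⟩ := hL.exists_marker h0 h1
  rw [show mark L k = mark L k - p + p by omega,
    prefix_drop_add_iff hper (by omega) (by rw [length_marker]; omega)] at hm
  obtain ⟨k', h4, h5, h6, h7⟩ := hL.exists_mark_eq hm
  exact ⟨k', ⟨h4, h5, by omega, by omega⟩, by omega⟩

/-- If `s` is the first inner block with its marker in the first half of a square and `s + d` is the
block matching it in the second half, then `s + j` matches `s + d + j`. -/
theorem IsBlockWalk.match_add (hL : IsBlockWalk L)
    (hper : ∀ j < p, (flat L)[i + j]? = (flat L)[i + j + p]?) {s d : ℕ}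
    (hs : MarkerIn L i (i + p) s) (hd : MarkerIn L (i + p) (i + 2 * p) (s + d))
    (he : mark L (s + d) = mark L s + p) (hv : (blk L (s + d)).1 = (blk L s).1) (j : ℕ)
    (hj : MarkerIn L i (i + p) (s + j)) :
    s + d + j + 1 < L.length ∧ mark L (s + d + j) = mark L (s + j) + p ∧
      (blk L (s + d + j)).1 = (blk L (s + j)).1 := by
  induction j with
  | zero => exact ⟨hd.lt, he, hv⟩
  | succ j ih =>
    have hjlt := hj.lt
    have hle : mark L s ≤ mark L (s + j) := by
      rcases Nat.eq_zero_or_pos j with rfl | h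
      · rfl
      · have := mark_add_le (L := L) (j := s) (k := s + j) (by omega) (by omega)
        have := pos_le_mark (L := L) (s + j)
        omega
    have hlt := mark_add_le (L := L) (j := s + j) (k := s + (j + 1)) (by omega) (by omega)
    have hlt' := pos_le_mark (L := L) (s + (j + 1))
    have hs1 := hs.le_mark
    have hs0 := hs.pos
    have hj1 := hj.mark_le
    obtain ⟨h1, h2, -⟩ := ih ⟨by omega, by omega, by omega, by omega⟩
    obtain ⟨k', hk', h4, h5⟩ := hL.exists_shift hper hj
    have hk'lt := hk'.lt
    have hk'le := hk'.mark_le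
    have hgt : s + d + j < k' := lt_of_mark_lt (L := L) (by omega) (by omega)
    have hk : k' = s + d + j + 1 := by
      by_contra hne
      have h6 := mark_add_le (L := L) (j := s + d + j) (k := s + d + j + 1) (by omega) (by omega)
      have h7 := mark_add_le (L := L) (j := s + d + j + 1) (k := k') (by omega) (by omega)
      have h8 := pos_le_mark (L := L) (s + d + j + 1)
      have h9 := pos_le_mark (L := L) k'
      obtain ⟨k, hk, hkm⟩ := hL.exists_unshift hper (k := s + d + j + 1)
        ⟨by omega, by omega, by omega, by omega⟩
      have := hk.lt
      have h10 : s + j < k := lt_of_mark_lt (L := L) (by omega) (by omega)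
      have h11 : k < s + (j + 1) := lt_of_mark_lt (L := L) (by omega) (by omega)
      omega
    subst hk
    exact ⟨by omega, h4, h5⟩

theorem IsBlockWalk.blk_pred_eq (hL : IsBlockWalk L)
    (hper : ∀ j < p, (flat L)[i + j]? = (flat L)[i + j + p]?) {s t : ℕ} (hs0 : 0 < s)
    (hs : s < L.length) (ht : t + 1 < L.length) {z : V} (hz : (blk L s).1 = Sum.inl z)
    (hv : (blk L (t + 1)).1 = (blk L s).1) (he : mark L (t + 1) = mark L s + p)
    (h1 : i + p + 21 ≤ pos L (t + 1)) (h2 : mark L s + 17 ≤ i + p) :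
    (blk L t).1 = (blk L (s - 1)).1 := by
  have harc := hL.arc (s - 1) (by omega)
  rw [Nat.sub_add_cancel hs0] at harc
  refine pred_eq_of_suffix (hv.trans hz) hz (hL.arc t ht) harc
    (W := (flat L).take (mark L s + 17)) ?_ ?_
  · have hpt := pos_succ (L := L) (k := t) (by omega)
    have hlt := length_blockWord (blk L t)
    have hle := offset_add_le (blk L (t + 1))
    rw [mark] at he
    refine suffix_take_of_prefix_drop (q := pos L (t + 1) - 21 - p) ?_
      (by simp only [List.length_append, List.length_drop, List.length_take]; omega)
    rw [← prefix_drop_add_iff hper (by omega)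
      (by simp only [List.length_append, List.length_drop, List.length_take]; omega)]
    rw [show pos L (t + 1) - 21 - p + p = pos L t + ((blockWord (blk L t)).length - 21) by omega,
      ← List.drop_drop, drop_pos_eq_append (by omega), List.drop_append_of_le_length (by omega),
      List.prefix_append_right_inj, drop_pos_eq_append ht]
    exact (List.take_prefix _ _).trans (List.prefix_append _ _)
  · have hle := offset_add_le (blk L s)
    have hps := pos_succ (L := L) (k := s - 1) (by omega)
    have hd := drop_pos_eq_append (L := L) (k := s - 1) (by omega)
    rw [Nat.sub_add_cancel hs0] at hps hd
    refine suffix_take_of_prefix_drop (q := pos L (s - 1)) ?_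
      (by simp only [List.length_append, List.length_take, mark]; omega)
    rw [hd, List.prefix_append_right_inj, drop_pos_eq_append hs]
    exact (List.take_prefix _ _).trans (List.prefix_append _ _)

theorem IsBlockWalk.blk_succ_eq (hL : IsBlockWalk L)
    (hper : ∀ j < p, (flat L)[i + j]? = (flat L)[i + j + p]?) {t u : ℕ}
    (ht : t + 1 < L.length) (hu : u + 1 < L.length) {z : V} (hz : (blk L t).1 = Sum.inl z)
    (hv : (blk L u).1 = (blk L t).1) (he : mark L u = mark L t + p)
    (h1 : i ≤ mark L t) (h2 : pos L (t + 1) + 21 ≤ i + p) :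
    (blk L (t + 1)).1 = (blk L (u + 1)).1 := by
  refine succ_eq_of_prefix hz (hv.trans hz) (hL.arc t ht) (hL.arc u hu)
    (W := (flat L).drop (mark L u)) ?_ ?_
  · have hpt := pos_succ (L := L) (k := t) (by omega)
    have hle := offset_add_le (blk L t)
    rw [he, prefix_drop_add_iff hper h1
      (by simp only [List.length_append, List.length_drop, List.length_take, mark]; omega),
      mark, ← List.drop_drop, drop_pos_eq_append (by omega),
      List.drop_append_of_le_length (by omega), List.prefix_append_right_inj,
      drop_pos_eq_append ht]
    exact (List.take_prefix _ _).trans (List.prefix_append _ _)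
  · have hle := offset_add_le (blk L u)
    rw [mark, ← List.drop_drop, drop_pos_eq_append (by omega),
      List.drop_append_of_le_length (by omega), List.prefix_append_right_inj,
      drop_pos_eq_append hu]
    exact List.prefix_append _ _

theorem IsBlockWalk.exists_markerIn (hL : IsBlockWalk L) (hp : 0 < p)
    (hlen : i + 2 * p ≤ (flat L).length)
    (hper : ∀ j < p, (flat L)[i + j]? = (flat L)[i + j + p]?) :
    ∃ k, MarkerIn L i (i + p) k := by
  have hno : ∀ b, b + 3 ≤ L.length → pos L b ≤ i → i + 2 * p ≤ pos L (b + 1 + 1 + 1) → False := by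
    intro b hb h1 h2
    obtain ⟨j, hj, hne⟩ := hL.squareFree_window hb hp h1 h2
    exact hne (hper j hj)
  obtain ⟨a, ha, h1, h2⟩ := exists_block_of_lt (L := L) (q := i) (by omega)
  have hN := hL.four_le
  have h3 : a + 3 < L.length := by
    by_contra! h
    refine hno (L.length - 3) (by omega) ((pos_mono (by omega)).trans h1) ?_
    rwa [show L.length - 3 + 1 + 1 + 1 = L.length by omega, pos_length]
  have h4 : pos L (a + 1 + 1 + 1) < i + 2 * p := by
    by_contra! h
    exact hno a (by omega) h1 h
  have h5 := pos_le_mark (L := L) (a + 1)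
  have h6 := mark_add_le (L := L) (j := a + 1) (k := a + 1 + 1) (by omega) (by omega)
  have h7 := pos_le_mark (L := L) (a + 1 + 1)
  have h8 := mark_add_le (L := L) (j := a + 1 + 1) (k := a + 1 + 1 + 1) (by omega) (by omega)
  rcases Nat.lt_or_ge (i + p) (mark L (a + 1) + 17) with h | h
  · obtain ⟨k, hk, -⟩ := hL.exists_unshift hper (k := a + 1 + 1)
      ⟨by omega, by omega, by omega, by omega⟩
    exact ⟨k, hk⟩
  · exact ⟨a + 1, by omega, by omega, by omega, h⟩

theorem IsBlockWalk.squareFree_flat (hL : IsBlockWalk L) : SquareFree (flat L) := by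
  classical
  rw [squareFree_iff_getElem?]
  intro i p hp hlen
  by_contra! hper
  have hex := hL.exists_markerIn hp hlen hper
  obtain ⟨s, hs, hmin⟩ : ∃ s, MarkerIn L i (i + p) s ∧ ∀ k, MarkerIn L i (i + p) k → s ≤ k :=
    ⟨Nat.find hex, Nat.find_spec hex, fun k hk => Nat.find_min' hex hk⟩
  obtain ⟨s', hs', he, hv⟩ := hL.exists_shift hper hs
  obtain ⟨hs0, hs1, hs2, hs3⟩ := hs
  have hs'1 := hs'.lt
  have hs'3 := hs'.mark_le
  have hss' : s < s' := lt_of_mark_lt (L := L) (by omega) (by omega)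
  obtain ⟨d, rfl⟩ := Nat.exists_eq_add_of_le hss'.le
  have hmatch := hL.match_add hper ⟨hs0, hs1, hs2, hs3⟩ hs' he hv
  have hle : ∀ k, s ≤ k → k < L.length → i ≤ mark L k := by
    intro k hk hkl
    rcases hk.eq_or_lt with rfl | h
    · exact hs2
    · have := mark_add_le (L := L) (j := s) (by omega) h
      have := pos_le_mark (L := L) k
      omega
  have hlt : ∀ k, s ≤ k → k < s + d → mark L k < i + p := by
    intro k h1 h2
    by_contra! h
    have h3 := mark_add_le (L := L) (j := k) (by omega) h2
    have h4 := pos_le_mark (L := L) (s + d)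
    obtain ⟨k', hk', hkk'⟩ := hL.exists_unshift hper (k := k)
      ⟨by omega, by omega, h, by omega⟩
    have := hmin k' hk'
    have : k' < s := lt_of_mark_lt (L := L) (by omega) (by omega)
    omega
  have hin : ∀ k, s ≤ k → k + 1 < s + d → MarkerIn L i (i + p) k := by
    intro k h1 h2
    have h3 := mark_add_le (L := L) (j := k) (k := k + 1) (by omega) (by omega)
    have h4 := pos_le_mark (L := L) (k + 1)
    have h5 := hlt (k + 1) (by omega) (by omega)
    exact ⟨by omega, by omega, hle k h1 (by omega), by omega⟩
  obtain ⟨t, ht⟩ : ∃ t, s + d = t + 1 := ⟨s + d - 1, by omega⟩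
  by_cases hlast : MarkerIn L i (i + p) t
  · obtain ⟨hl, -⟩ := hmatch (t - s) (by rwa [Nat.add_sub_cancel' (by omega)])
    obtain ⟨j, hj, hne⟩ := hL.exists_ne (s := s) (d := d) (by omega) (by omega)
    have hj' : MarkerIn L i (i + p) (s + j) := by
      rcases Nat.lt_or_ge (s + j + 1) (s + d) with h | h
      · exact hin _ (by omega) h
      · rwa [show s + j = t by omega]
    exact hne (hmatch j hj').2.2.symm
  have hst : s < t := by
    by_contra! h
    obtain rfl : s = t := by omega
    exact hlast ⟨hs0, hs1, hs2, hs3⟩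
  obtain ⟨hl, hm, hvt⟩ := hmatch (t - 1 - s) (hin _ (by omega) (by omega))
  rw [show s + (t - 1 - s) = t - 1 by omega] at hm hvt
  rcases Nat.lt_or_ge (pos L (t + 1)) (i + p + 21) with h | h
  · have hpt := pos_succ (L := L) (k := t) (by omega)
    have hlt := length_blockWord (blk L t)
    obtain ⟨z, hz, -⟩ := hL.exists_marker (k := t - 1) (by omega) (by omega)
    have heq := hL.blk_succ_eq hper (t := t - 1) (u := s + d + (t - 1 - s)) (by omega) (by omega)
      hz hvt hm (hle _ (by omega) (by omega))
      (by rw [Nat.sub_add_cancel (by omega)]; omega)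
    obtain ⟨j, hj, hne⟩ := hL.exists_ne (s := s) (d := d) (by omega) (by omega)
    rcases Nat.lt_or_ge (s + j + 1) (s + d) with h' | h'
    · exact hne (hmatch j (hin _ (by omega) h')).2.2.symm
    · rw [show t - 1 + 1 = s + j by omega, show s + d + (t - 1 - s) + 1 = s + d + j by omega] at heq
      exact hne heq
  · obtain ⟨z, hz, -⟩ := hL.exists_marker (k := s) hs0 hs1
    rw [ht] at hv he
    have heq := hL.blk_pred_eq hper hs0 (by omega) (by omega) hz hv he h hs3
    obtain ⟨j, hj, hne⟩ := hL.exists_ne (s := s - 1) (d := d) (by omega) (by omega)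
    rcases Nat.eq_zero_or_pos j with rfl | hj0
    · rw [show t = s - 1 + d + 0 by omega] at heq
      exact hne heq.symm
    · have := (hmatch (j - 1) (hin _ (by omega) (by omega))).2.2
      rw [show s + d + (j - 1) = s - 1 + d + j by omega, show s + (j - 1) = s - 1 + j by omega]
        at this
      exact hne this.symm

end SquareFreeness

/-! ### Extremality -/

section Extremality

variable {L : List Block}

theorem IsBlockWalk.not_squareFree_insert_window (hL : IsBlockWalk L) {b g : ℕ}
    (hb : b + 1 < L.length) (h1 : pos L b + (bif isEnd (blk L b).1 then 0 else 1) ≤ g)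
    (h2 : g ≤ pos L (b + 1) +
      bif isEnd (blk L (b + 1)).1 then (blockWord (blk L (b + 1))).length else 0)
    (x : Fin 3) : ¬ SquareFree ((flat L).take g ++ [x] ++ (flat L).drop g) := by
  have hpos := pos_succ (L := L) (k := b) (by omega)
  have hd := drop_pos_eq_append (L := L) (k := b) (by omega)
  rw [drop_pos_eq_append hb, ← List.append_assoc] at hd
  have hpair := not_squareFree_insert_pair (hL.arc b hb) (g := g - pos L b) (by omega) (by omega) x
  intro hsf
  refine hpair (hsf.of_infix ?_)
  set m := blockWord (blk L b) ++ blockWord (blk L (b + 1)) with hm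
  have hg : g - pos L b ≤ m.length := by
    have : (bif isEnd (blk L (b + 1)).1 then (blockWord (blk L (b + 1))).length else 0) ≤
        (blockWord (blk L (b + 1))).length := by
      cases isEnd (blk L (b + 1)).1 <;> simp
    rw [hm, List.length_append]
    omega
  have e1 : (flat L).take g = (flat L).take (pos L b) ++ m.take (g - pos L b) := by
    rw [show g = pos L b + (g - pos L b) by omega, List.take_add, hd,
      List.take_append_of_le_length hg, Nat.add_sub_cancel_left]
  have e2 : (flat L).drop g =
      m.drop (g - pos L b) ++ (flat L).drop (pos L (b + 1 + 1)) := by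
    rw [← List.drop_append_of_le_length hg, ← hd, List.drop_drop]
    congr 1
    omega
  exact ⟨(flat L).take (pos L b), (flat L).drop (pos L (b + 1 + 1)), by
    rw [e1, e2]; simp only [List.append_assoc]⟩

theorem IsBlockWalk.not_squareFree_insert (hL : IsBlockWalk L) {g : ℕ} (hg : g ≤ (flat L).length)
    (x : Fin 3) : ¬ SquareFree ((flat L).take g ++ [x] ++ (flat L).drop g) := by
  have hN := hL.four_le
  rcases Nat.eq_zero_or_pos g with rfl | hg0
  · refine hL.not_squareFree_insert_window (b := 0) (by omega) ?_ (Nat.zero_le _) x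
    rw [(hL.isEnd_iff 0 (by omega)).2 (Or.inl rfl)]
    simp [pos_zero]
  obtain ⟨k, hk, h1, h2⟩ := exists_block_of_lt (L := L) (q := g - 1) (by omega)
  rcases Nat.lt_or_ge (k + 1) L.length with hk1 | hk1
  · refine hL.not_squareFree_insert_window hk1 ?_ (by omega) x
    cases isEnd (blk L k).1 <;> simp <;> omega
  · have hlt := mark_add_le (L := L) (j := k - 1) (k := k) (by omega) (by omega)
    have hm := pos_le_mark (L := L) (k - 1)
    have hps := pos_succ hk
    have hend := (hL.isEnd_iff k hk).2 (Or.inr (by omega))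
    obtain ⟨k, rfl⟩ := Nat.exists_eq_add_of_le' (show 1 ≤ k by omega)
    rw [Nat.add_sub_cancel] at hlt hm
    refine hL.not_squareFree_insert_window (b := k) (by omega) ?_ ?_ x
    · cases isEnd (blk L k).1 <;> simp <;> omega
    · rw [hend, cond_true]
      omega

theorem IsBlockWalk.extremalSquareFree_flat (hL : IsBlockWalk L) :
    ExtremalSquareFree (flat L) := by
  refine ⟨hL.squareFree_flat, ?_⟩
  rintro _ ⟨u, v, x, huv, rfl⟩
  have h := hL.not_squareFree_insert (g := u.length) (by rw [huv]; simp) x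
  rwa [huv, List.take_left, List.drop_left] at h

end Extremality

/-! ### Walks in the extended digraph -/

theorem exists_flat_of_mem_substSet {l : List Vhat} {W : List (Fin 3)}
    (hW : W ∈ SubstSet delta l) : ∃ L : List Block, L.map Prod.fst = l ∧ flat L = W := by
  induction l generalizing W with
  | nil => exact ⟨[], rfl, hW.symm⟩
  | cons a l ih =>
    obtain ⟨A, hA, B, hB, rfl⟩ := hW
    obtain ⟨L, hL, rfl⟩ := ih hB
    obtain ⟨i, rfl⟩ : ∃ i, blockWord (a, i) = A := by
      match a, hA with
      | Sum.inl x, hA =>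
        rcases hA with rfl | rfl
        · exact ⟨false, rfl⟩
        · exact ⟨true, rfl⟩
      | Sum.inr (x, false), hA => exact ⟨false, hA.symm⟩
      | Sum.inr (x, true), hA => exact ⟨false, hA.symm⟩
    exact ⟨(a, i) :: L, by simp [hL], rfl⟩

/-- The walk in the extended digraph obtained from a walk `u` in the digraph by adding an initial
vertex `a` and a final vertex `b`. -/
def extend (a : V × Bool) (u : List V) (b : V × Bool) : List Vhat :=
  Sum.inr a :: (u.map Sum.inl ++ [Sum.inr b])

section Extend

variable {a b : V × Bool} {u : List V}

theorem length_extend : (extend a u b).length = u.length + 2 := by simp [extend]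

theorem extend_getElem?_zero : (extend a u b)[0]? = some (Sum.inr a) := rfl

theorem extend_getElem?_succ {k : ℕ} (hk : k < u.length) :
    (extend a u b)[k + 1]? = some (Sum.inl u[k]) := by
  simp [extend, List.getElem?_append, hk]

theorem extend_getElem?_last : (extend a u b)[u.length + 1]? = some (Sum.inr b) := by
  simp [extend]

theorem squareFree_extend (h0 : 0 < u.length) (hu : SquareFree u) :
    SquareFree (extend a u b) := by
  rw [squareFree_iff_getElem?] at hu ⊢
  intro i p hp hlen
  rw [length_extend] at hlen
  rcases Nat.eq_zero_or_pos i with rfl | hi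
  · refine ⟨0, hp, ?_⟩
    obtain ⟨p, rfl⟩ := Nat.exists_eq_add_of_le' (show 1 ≤ p from hp)
    rw [show 0 + 0 + (p + 1) = p + 1 by omega, extend_getElem?_succ (by omega)]
    simp [extend_getElem?_zero]
  obtain ⟨i, rfl⟩ := Nat.exists_eq_add_of_le' (show 1 ≤ i from hi)
  rcases Nat.lt_or_ge (i + 2 * p) (u.length + 1) with h | h
  · obtain ⟨j, hj, hne⟩ := hu i p hp (by omega)
    refine ⟨j, hj, ?_⟩
    rw [List.getElem?_eq_getElem (by omega), List.getElem?_eq_getElem (by omega)] at hne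
    rw [show i + 1 + j + p = i + j + p + 1 by omega, show i + 1 + j = i + j + 1 by omega,
      extend_getElem?_succ (by omega), extend_getElem?_succ (by omega)]
    simpa using hne
  · refine ⟨p - 1, by omega, ?_⟩
    rw [show i + 1 + (p - 1) + p = u.length + 1 by omega,
      show i + 1 + (p - 1) = i + p - 1 + 1 by omega, extend_getElem?_succ (by omega),
      extend_getElem?_last]
    simp

end Extend

theorem isBlockWalk_of_map_fst {L : List Block} {x y : V} {w : List V}
    (hwalk : (x :: w ++ [y]).IsChain Arc) (hsf : SquareFree (x :: w ++ [y]))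
    (hL : L.map Prod.fst = extend (x, false) (x :: w ++ [y]) (y, true)) : IsBlockWalk L := by
  have hlen : L.length = w.length + 4 := by
    have := congrArg List.length hL
    rw [length_extend] at this
    simpa using this
  have hblk : ∀ {k : ℕ}, k < L.length → ∀ {v : Vhat},
      (extend (x, false) (x :: w ++ [y]) (y, true))[k]? = some v → (blk L k).1 = v := by
    intro k hk v hv
    rw [← hL, List.getElem?_map, List.getElem?_eq_getElem hk, Option.map_some,
      Option.some.injEq] at hv
    rw [blk_eq hk, hv]
  have hul : (x :: w ++ [y]).length = w.length + 2 := by simp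
  have hfirst : (blk L 0).1 = Sum.inr (x, false) := hblk (by omega) extend_getElem?_zero
  have hlast : (blk L (w.length + 3)).1 = Sum.inr (y, true) := by
    refine hblk (by omega) ?_
    have := extend_getElem?_last (a := (x, false)) (b := (y, true)) (u := x :: w ++ [y])
    rwa [hul] at this
  have hinner : ∀ {k : ℕ} (hk : k < (x :: w ++ [y]).length),
      (blk L (k + 1)).1 = Sum.inl (x :: w ++ [y])[k] := fun hk =>
    hblk (by omega) (extend_getElem?_succ hk)
  refine ⟨fun k hk => ?_, fun k hk => ?_, ?_, by omega⟩
  · rcases Nat.eq_zero_or_pos k with rfl | hk0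
    · rw [hfirst, hinner (by omega)]
      rfl
    obtain ⟨k, rfl⟩ := Nat.exists_eq_add_of_le' (show 1 ≤ k from hk0)
    rcases Nat.lt_or_ge k (w.length + 1) with h | h
    · rw [hinner (by omega), hinner (by omega)]
      exact List.isChain_iff_getElem.1 hwalk k (by omega)
    · obtain rfl : k = w.length + 1 := by omega
      rw [hinner (by omega), hlast]
      change (x :: w ++ [y])[w.length + 1] = y
      simp
  · rcases Nat.eq_zero_or_pos k with rfl | hk0
    · simp [hfirst, isEnd]
    obtain ⟨k, rfl⟩ := Nat.exists_eq_add_of_le' (show 1 ≤ k from hk0)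
    rcases Nat.lt_or_ge k (w.length + 2) with h | h
    · rw [hinner (by omega)]
      simp only [isEnd, Bool.false_eq_true, false_iff]
      omega
    · obtain rfl : k = w.length + 2 := by omega
      rw [hlast]
      simp only [isEnd, true_iff]
      omega
  · rw [hL]
    exact squareFree_extend (by omega) hsf

/-- Corollary 10: if `w = x w' y` is a square-free walk in `D` (of length at least `2`),
then every word in `δ(p_x w s_y)` is extremal square-free. -/
theorem delta_extremal (x y : V) (w' : List V)
    (hwalk : List.Chain' Arc (x :: w' ++ [y]))
    (hsf : SquareFree (x :: w' ++ [y])) :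
    ∀ W ∈ SubstSet delta
        (Sum.inr (x, false) :: ((x :: w' ++ [y]).map Sum.inl ++ [Sum.inr (y, true)])),
      ExtremalSquareFree W := by
  intro W hW
  obtain ⟨L, hL, rfl⟩ := exists_flat_of_mem_substSet hW
  exact (isBlockWalk_of_map_fst hwalk hsf hL).extremalSquareFree_flat
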